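/- arXiv:1903.08104 — 2 statements merged into one kernel-verified Lean document; each statement's English description precedes it below -/
import Mathlib

section
/- Let X be a complex analytic space and X' ⊂ X an open domain. Suppose X and X' are both holomorphically convex and X' is Runge in X. Let (π', Y') and (π, Y) be the Remmert reductions of X' and X respectively. Then Y' embeds into Y as an open domain: the induced holomorphic map σ: Y' → Y satisfying σ ∘ π' = π ∘ j (where j: X' → X is the inclusion) is an injective open holomorphic embedding. -/
/-!
Preliminary definitions.

We model a (reduced) complex analytic space as a Hausdorff topological space
equipped with a sheaf of continuous ℂ-valued functions (its holomorphic
functions) which is locally isomorphic to the canonical model: an analytic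
subset `A` of an open set `Ω ⊆ ℂⁿ`, with the sheaf of functions that locally
extend to holomorphic functions of the ambient ℂⁿ.
-/

open Set Topology Filter Function

noncomputable section

/-- Holomorphic (= ℂ-analytic) functions on a subset of ℂⁿ. -/
def CnHolo {n : ℕ} (U : Set (Fin n → ℂ)) (f : (Fin n → ℂ) → ℂ) : Prop :=
  AnalyticOnNhd ℂ f U

/-- `A` is an analytic subset of the open set `Ω ⊆ ℂⁿ`: locally it is the common
zero set of a family of holomorphic functions. -/
def IsAnalyticInCn {n : ℕ} (Ω A : Set (Fin n → ℂ)) : Prop :=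
  A ⊆ Ω ∧ ∀ z ∈ Ω, ∃ V : Set (Fin n → ℂ), IsOpen V ∧ z ∈ V ∧ V ⊆ Ω ∧
    ∃ F : Set ((Fin n → ℂ) → ℂ), (∀ f ∈ F, CnHolo V f) ∧
      A ∩ V = {w ∈ V | ∀ f ∈ F, f w = 0}

/-- A sheaf of continuous ℂ-valued functions on a topological space `X`:
`Holo U f` reads "`f` is holomorphic on the open set `U`" (only the values of
`f` on `U` matter, by `congr_holo`). -/
structure FunctionSheaf (X : Type) [TopologicalSpace X] where
  Holo : Set X → (X → ℂ) → Prop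
  isOpen_of_holo : ∀ {U : Set X} {f : X → ℂ}, Holo U f → IsOpen U
  congr_holo : ∀ {U : Set X} {f g : X → ℂ}, Holo U f → (∀ x ∈ U, f x = g x) → Holo U g
  mono : ∀ {U V : Set X} {f : X → ℂ}, Holo U f → IsOpen V → V ⊆ U → Holo V f
  glue : ∀ {U : Set X} {f : X → ℂ}, IsOpen U →
    (∀ x ∈ U, ∃ V : Set X, x ∈ V ∧ V ⊆ U ∧ Holo V f) → Holo U f
  continuousOn : ∀ {U : Set X} {f : X → ℂ}, Holo U f → ContinuousOn f U
  const_mem : ∀ {U : Set X}, IsOpen U → ∀ c : ℂ, Holo U (fun _ => c)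
  add_mem : ∀ {U : Set X} {f g : X → ℂ}, Holo U f → Holo U g → Holo U (f + g)
  mul_mem : ∀ {U : Set X} {f g : X → ℂ}, Holo U f → Holo U g → Holo U (f * g)
  neg_mem : ∀ {U : Set X} {f : X → ℂ}, Holo U f → Holo U (-f)

/-- A (reduced) complex analytic space structure on a Hausdorff topological
space `X`: a function sheaf which, near every point, is isomorphic (via a chart
`h`) to the canonical sheaf on an analytic subset `A` of an open set `Ω ⊆ ℂⁿ`. -/
structure CStruct (X : Type) [TopologicalSpace X] : Type where
  O : FunctionSheaf X
  t2 : T2Space X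
  locallyModel : ∀ x : X, ∃ (U : Set X) (n : ℕ) (Ω A : Set (Fin n → ℂ))
      (h : X → Fin n → ℂ),
    IsOpen U ∧ x ∈ U ∧ IsOpen Ω ∧ IsAnalyticInCn Ω A ∧
    ContinuousOn h U ∧ Set.InjOn h U ∧ h '' U = A ∧
    (∀ s : Set X, s ⊆ U → (IsOpen s ↔ ∃ V : Set (Fin n → ℂ), IsOpen V ∧ s = U ∩ h ⁻¹' V)) ∧
    (∀ W : Set X, IsOpen W → W ⊆ U → ∀ f : X → ℂ,
      (O.Holo W f ↔ ∀ y ∈ W, ∃ (V : Set (Fin n → ℂ)) (F : (Fin n → ℂ) → ℂ),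
        IsOpen V ∧ h y ∈ V ∧ V ⊆ Ω ∧ CnHolo V F ∧
        ∀ z ∈ U, h z ∈ V → z ∈ W ∧ f z = F (h z)))

namespace CStruct

variable {X Y : Type} [TopologicalSpace X] [TopologicalSpace Y]

/-- `f` is holomorphic on the (arbitrary) subset `A ⊆ X`: near every point of
`A`, `f` agrees on `A` with a holomorphic function.  For open `A` this is
equivalent to `S.O.Holo A f`. -/
def HoloOn (S : CStruct X) (A : Set X) (f : X → ℂ) : Prop :=
  ∀ x ∈ A, ∃ (W : Set X) (F : X → ℂ), IsOpen W ∧ x ∈ W ∧ S.O.Holo W F ∧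
    ∀ y ∈ W ∩ A, f y = F y

/-- The holomorphically convex hull of `K` in the domain `A`, taken with respect
to the functions holomorphic on `A`. -/
def hullIn (S : CStruct X) (A K : Set X) : Set X :=
  {x ∈ A | ∀ f : X → ℂ, S.HoloOn A f → ‖f x‖ ≤ sSup ((fun y => ‖f y‖) '' K)}

/-- The domain `A ⊆ X` is holomorphically convex: hulls of compact subsets of
`A` are compact. -/
def HolConvexOn (S : CStruct X) (A : Set X) : Prop :=
  ∀ K : Set X, K ⊆ A → IsCompact K → IsCompact (S.hullIn A K)

/-- `X` is a holomorphically convex complex space. -/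
def HolConvex (S : CStruct X) : Prop := S.HolConvexOn Set.univ

/-- The functions holomorphic on the domain `A` separate the points of `A`. -/
def SeparatesOn (S : CStruct X) (A : Set X) : Prop :=
  ∀ x ∈ A, ∀ y ∈ A, x ≠ y → ∃ f : X → ℂ, S.HoloOn A f ∧ f x ≠ f y

/-- A Stein space: holomorphically convex, and global holomorphic functions
separate points. -/
def Stein (S : CStruct X) : Prop := S.HolConvex ∧ S.SeparatesOn Set.univ

/-- `φ` is a holomorphic map on the domain `A ⊆ X`, with values in the complex
space `Y`: it is continuous and pulls holomorphic functions back to holomorphic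
functions. -/
def IsHoloMapOn (S : CStruct X) (T : CStruct Y) (A : Set X) (φ : X → Y) : Prop :=
  ContinuousOn φ A ∧ ∀ (U : Set Y) (g : Y → ℂ), IsOpen U → T.O.Holo U g →
    S.HoloOn (A ∩ φ ⁻¹' U) (g ∘ φ)

/-- A holomorphic map `X → Y`. -/
def IsHoloMap (S : CStruct X) (T : CStruct Y) (φ : X → Y) : Prop :=
  S.IsHoloMapOn T Set.univ φ

/-- `φ` is proper on the domain `A ⊆ X`: preimages (within `A`) of compact sets
are compact. -/
def IsProperOn (A : Set X) (φ : X → Y) : Prop :=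
  ∀ K : Set Y, IsCompact K → IsCompact (A ∩ φ ⁻¹' K)

/-- The canonical morphism `O_Y → φ_* O_{A}` is an isomorphism of sheaves of
rings: for every open `U ⊆ Y`, pulling back along `φ` is a bijection from
`O_Y(U)` onto the holomorphic functions on `A ∩ φ⁻¹(U)`.  (For `A = univ` this
says `φ_* O_X ≅ O_Y`.) -/
def DirectImageEqOn (S : CStruct X) (T : CStruct Y) (A : Set X) (φ : X → Y) : Prop :=
  ∀ U : Set Y, IsOpen U →
    (∀ g₁ g₂ : Y → ℂ, T.O.Holo U g₁ → T.O.Holo U g₂ →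
      (∀ x ∈ A ∩ φ ⁻¹' U, g₁ (φ x) = g₂ (φ x)) → ∀ y ∈ U, g₁ y = g₂ y) ∧
    (∀ f : X → ℂ, S.HoloOn (A ∩ φ ⁻¹' U) f →
      ∃ g : Y → ℂ, T.O.Holo U g ∧ ∀ x ∈ A ∩ φ ⁻¹' U, f x = g (φ x))

/-- `φ_* O_X ≅ O_Y` (as sheaves of rings, via the canonical morphism). -/
def DirectImageEq (S : CStruct X) (T : CStruct Y) (φ : X → Y) : Prop :=
  S.DirectImageEqOn T Set.univ φ

/-- `(φ, Y)` is a Remmert reduction of the domain `A ⊆ X`: `Y` is Stein and `φ`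
is a proper holomorphic map with `φ_* O_A ≅ O_Y`. -/
def IsRemmertReductionOn (S : CStruct X) (T : CStruct Y) (A : Set X) (φ : X → Y) : Prop :=
  T.Stein ∧ S.IsHoloMapOn T A φ ∧ IsProperOn A φ ∧ S.DirectImageEqOn T A φ

/-- `(φ, Y)` is a Remmert reduction of `X`. -/
def IsRemmertReduction (S : CStruct X) (T : CStruct Y) (φ : X → Y) : Prop :=
  S.IsRemmertReductionOn T Set.univ φ

/-- `A` is a (closed) complex analytic subset of `X`: locally it is the common
zero set of a family of holomorphic functions. -/
def IsAnalyticSubset (S : CStruct X) (A : Set X) : Prop :=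
  ∀ x : X, ∃ U : Set X, IsOpen U ∧ x ∈ U ∧ ∃ F : Set (X → ℂ),
    (∀ f ∈ F, S.O.Holo U f) ∧ A ∩ U = {y ∈ U | ∀ f ∈ F, f y = 0}

/-- `Sx S x`: the union of all compact connected complex analytic subsets of `X`
containing `x`. -/
def Sx (S : CStruct X) (x : X) : Set X :=
  ⋃₀ {A : Set X | S.IsAnalyticSubset A ∧ IsCompact A ∧ IsConnected A ∧ x ∈ A}

/-- The relation `R`: `x R x'` iff `S_x ∩ S_{x'} ≠ ∅`. -/
def Rrel (S : CStruct X) (x x' : X) : Prop := (S.Sx x ∩ S.Sx x').Nonempty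

/-- `B` is a Runge subdomain of `A` (`B ⊆ A`): every function holomorphic on `B`
can be approximated, uniformly on every compact subset of `B`, by functions
holomorphic on `A`. -/
def RungeIn (S : CStruct X) (B A : Set X) : Prop :=
  ∀ f : X → ℂ, S.HoloOn B f → ∀ K : Set X, IsCompact K → K ⊆ B → ∀ ε : ℝ, 0 < ε →
    ∃ g : X → ℂ, S.HoloOn A g ∧ ∀ x ∈ K, ‖f x - g x‖ < ε

end CStruct

namespace CStruct

variable {X Y : Type} [TopologicalSpace X] [TopologicalSpace Y]

/-- A complex space is locally compact. -/
theorem weaklyLocallyCompactSpace (S : CStruct X) : WeaklyLocallyCompactSpace X := by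
  refine ⟨fun x => ?_⟩
  obtain ⟨U, n, Ω, A, h, hU, hxU, -, ⟨hAΩ, hA⟩, hcont, -, himg, hind, -⟩ := S.locallyModel x
  have hxA : h x ∈ A := himg ▸ mem_image_of_mem h hxU
  obtain ⟨V, hV, hxV, -, F, hF, hAV⟩ := hA (h x) (hAΩ hxA)
  obtain ⟨r, hr, hrV⟩ := Metric.nhds_basis_closedBall.mem_iff.1 (hV.mem_nhds hxV)
  have hcompact : IsCompact (A ∩ Metric.closedBall (h x) r) := by
    have heq : A ∩ Metric.closedBall (h x) r =
        Metric.closedBall (h x) r ∩ ⋂ f ∈ F, Metric.closedBall (h x) r ∩ f ⁻¹' {0} := by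
      ext w
      simp only [mem_inter_iff, mem_iInter, mem_preimage, mem_singleton_iff]
      have hw : w ∈ A ∩ V ↔ w ∈ V ∧ ∀ f ∈ F, f w = 0 := by rw [hAV]; rfl
      constructor
      · rintro ⟨hwA, hwB⟩
        exact ⟨hwB, fun f hf => ⟨hwB, (hw.1 ⟨hwA, hrV hwB⟩).2 f hf⟩⟩
      · rintro ⟨hwB, hwF⟩
        exact ⟨(hw.2 ⟨hrV hwB, fun f hf => (hwF f hf).2⟩).1, hwB⟩
    rw [heq]
    refine (isCompact_closedBall _ _).inter_right (isClosed_biInter fun f hf => ?_)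
    exact ((hF f hf).continuousOn.mono hrV).preimage_isClosed_of_isClosed
      Metric.isClosed_closedBall isClosed_singleton
  have hinducing : IsInducing (U.domRestrict h) := by
    refine ⟨TopologicalSpace.ext (funext fun s => propext ?_)⟩
    rw [hU.isOpenEmbedding_subtypeVal.isOpen_iff_image_isOpen,
      hind _ (Subtype.coe_image_subset U s), isOpen_induced_iff]
    refine exists_congr fun V => and_congr_right fun _ => ?_
    rw [← Subtype.image_preimage_coe, Subtype.val_injective.image_injective.eq_iff, eq_comm]
    rfl
  refine ⟨U ∩ h ⁻¹' Metric.closedBall (h x) r, ?_,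
    inter_mem (hU.mem_nhds hxU)
      ((hcont.continuousAt (hU.mem_nhds hxU)).preimage_mem_nhds (Metric.closedBall_mem_nhds _ hr))⟩
  rw [← Subtype.image_preimage_coe]
  refine IsCompact.image ?_ continuous_subtype_val
  rw [hinducing.isCompact_iff]
  convert hcompact using 1
  change U.domRestrict h '' (U.domRestrict h ⁻¹' Metric.closedBall (h x) r) = _
  rw [image_preimage_eq_range_inter, range_domRestrict, himg]

/-- A continuous proper map on `A` with values in a complex space is closed. -/
theorem IsProperOn.isClosed_image {T : CStruct Y} {A C : Set X} {φ : X → Y}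
    (hφ : IsProperOn A φ) (hcont : ContinuousOn φ A) (hC : IsClosed C) :
    IsClosed (φ '' (A ∩ C)) := by
  have := T.weaklyLocallyCompactSpace
  have := T.t2
  have hproper : IsProperMap (A.domRestrict φ) := by
    refine isProperMap_iff_isCompact_preimage.2 ⟨hcont.domRestrict, fun K hK => ?_⟩
    rw [Subtype.isCompact_iff]
    convert hφ K hK using 1
    exact Subtype.image_preimage_coe A (φ ⁻¹' K)
  convert hproper.isClosedMap _ (hC.preimage continuous_subtype_val) using 1
  rw [← Subtype.image_preimage_coe, image_image]
  rfl

theorem IsRemmertReductionOn.exists_preimage {S : CStruct X} {T : CStruct Y} {A : Set X}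
    {φ : X → Y} (hφ : S.IsRemmertReductionOn T A φ) (y : Y) : ∃ x ∈ A, φ x = y := by
  by_contra! hy
  obtain ⟨-, ⟨hcont, -⟩, hproper, hdir⟩ := hφ
  have hopen : IsOpen (φ '' A)ᶜ := by
    simpa using (hproper.isClosed_image (T := T) hcont isClosed_univ).isOpen_compl
  refine zero_ne_one ((hdir _ hopen).1 _ _ (T.O.const_mem hopen 0) (T.O.const_mem hopen 1)
    (fun x hx => absurd (mem_image_of_mem φ hx.1) hx.2) y ?_)
  rintro ⟨x, hx, rfl⟩
  exact hy x hx rfl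

/-- A neighbourhood of a fibre contains the preimage of a neighbourhood of the base point. -/
theorem IsProperOn.exists_isOpen_preimage_subset {T : CStruct Y} {φ : X → Y}
    (hφ : IsProperOn univ φ) (hcont : ContinuousOn φ univ) {V : Set X} (hV : IsOpen V) {y : Y}
    (hy : φ ⁻¹' {y} ⊆ V) : ∃ U : Set Y, IsOpen U ∧ y ∈ U ∧ φ ⁻¹' U ⊆ V := by
  refine ⟨(φ '' Vᶜ)ᶜ, ?_, ?_, ?_⟩
  · simpa using (hφ.isClosed_image (T := T) hcont hV.isClosed_compl).isOpen_compl
  · rintro ⟨x, hx, hxy⟩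
    exact hx (hy hxy)
  · intro x hx
    by_contra hxV
    exact hx (mem_image_of_mem φ hxV)

/-- Fibres of a Remmert reduction are connected: an open set meeting a fibre in a compact
nonempty set contains it. -/
theorem IsRemmertReduction.mem_of_isCompact_fiber_inter {S : CStruct X} {T : CStruct Y}
    {φ : X → Y} (hφ : S.IsRemmertReduction T φ) {B : Set X} (hB : IsOpen B) {x z : X}
    (hx : x ∈ B) (hcompact : IsCompact (B ∩ φ ⁻¹' {φ x})) (hz : φ z = φ x) : z ∈ B := by
  by_contra hzB
  obtain ⟨-, ⟨hcont, -⟩, hproper, hdir⟩ := hφ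
  have := S.t2
  have hfiber : IsCompact (φ ⁻¹' {φ x} \ B) := by
    simpa using (hproper {φ x} isCompact_singleton).diff hB
  obtain ⟨V₀, V₁, hV₀, hV₁, hsub₀, hsub₁, hdisj⟩ :=
    SeparatedNhds.of_isCompact_isCompact hcompact hfiber
      (disjoint_left.2 fun w hw hw' => hw'.2 hw.1)
  obtain ⟨U, hU, hxU, hUV⟩ := hproper.exists_isOpen_preimage_subset (T := T) hcont
    (hV₀.union hV₁) (y := φ x) fun w hw => by
      by_cases hwB : w ∈ B
      · exact Or.inl (hsub₀ ⟨hwB, hw⟩)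
      · exact Or.inr (hsub₁ ⟨hw, hwB⟩)
  have hholo : S.HoloOn (univ ∩ φ ⁻¹' U) (V₁.indicator 1) := by
    rintro w ⟨-, hw⟩
    rcases hUV hw with hw | hw
    · exact ⟨V₀, _, hV₀, hw, S.O.const_mem hV₀ 0, fun v hv =>
        indicator_of_notMem (disjoint_left.1 hdisj hv.1) _⟩
    · exact ⟨V₁, _, hV₁, hw, S.O.const_mem hV₁ 1, fun v hv => indicator_of_mem hv.1 _⟩
  obtain ⟨g, -, hg⟩ := (hdir U hU).2 _ hholo
  have hgx := hg x ⟨trivial, hxU⟩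
  have hgz := hg z ⟨trivial, by rwa [mem_preimage, hz]⟩
  rw [indicator_of_notMem (disjoint_left.1 hdisj (hsub₀ ⟨hx, rfl⟩))] at hgx
  rw [indicator_of_mem (hsub₁ ⟨hz, hzB⟩), hz, ← hgx] at hgz
  exact one_ne_zero hgz

end CStruct

/-- Let `X'` be an open domain in a complex space `X`, with
both `X` and `X'` holomorphically convex and `X'` Runge in `X`.  Let
`(π', Y')` and `(π, Y)` be the Remmert reductions of `X'` and `X`.  Then the
induced holomorphic map `σ : Y' → Y` with `σ ∘ π' = π` on `X'` is an injective,
open, holomorphic embedding: it is injective and open, and it is a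
biholomorphism from `Y'` onto the open set `σ(Y') ⊆ Y`. -/
theorem reduction_of_runge_subdomain_embeds
    {X Y Y' : Type} [TopologicalSpace X] [TopologicalSpace Y] [TopologicalSpace Y']
    (S : CStruct X) (T : CStruct Y) (T' : CStruct Y')
    (X' : Set X) (hX'open : IsOpen X')
    (hconvX : S.HolConvex) (hconvX' : S.HolConvexOn X')
    (hRunge : S.RungeIn X' Set.univ)
    (π : X → Y) (hred : S.IsRemmertReduction T π)
    (π' : X → Y') (hred' : S.IsRemmertReductionOn T' X' π')
    (σ : Y' → Y) (hσ : T'.IsHoloMap T σ)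
    (hfac : ∀ x ∈ X', σ (π' x) = π x) :
    Function.Injective σ ∧ IsOpenMap σ ∧ IsOpen (Set.range σ) ∧
      ∃ τ : Y → Y', T.IsHoloMapOn T' (Set.range σ) τ ∧
        (∀ y' : Y', τ (σ y') = y') ∧ ∀ y ∈ Set.range σ, σ (τ y) = y := by
  have hred₀ := hred
  have hred₀' := hred'
  obtain ⟨-, ⟨hcont, -⟩, hproper, hdir⟩ := hred
  obtain ⟨⟨-, hsep⟩, ⟨hcont', hholo'⟩, hproper', -⟩ := hred'
  have hinj : Injective σ := by
    intro y₁ y₂ hy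
    by_contra hne
    obtain ⟨x₁, hx₁, rfl⟩ := hred₀'.exists_preimage y₁
    obtain ⟨x₂, hx₂, rfl⟩ := hred₀'.exists_preimage y₂
    obtain ⟨f, hf, hfne⟩ := hsep _ trivial _ trivial hne
    have hfO : T'.O.Holo univ f := T'.O.glue isOpen_univ fun y _ => by
      obtain ⟨W, F, -, hyW, hF, hfF⟩ := hf y trivial
      exact ⟨W, hyW, subset_univ W, T'.O.congr_holo hF fun z hz => (hfF z ⟨hz, trivial⟩).symm⟩
    have hpull : S.HoloOn X' (f ∘ π') := by simpa using hholo' univ f isOpen_univ hfO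
    obtain ⟨g, hg, hgf⟩ := hRunge _ hpull {x₁, x₂} (toFinite _).isCompact
      (by rintro x (rfl | rfl) <;> assumption) (‖f (π' x₁) - f (π' x₂)‖ / 2)
      (half_pos (norm_pos_iff.2 (sub_ne_zero.2 hfne)))
    obtain ⟨G, -, hG⟩ := (hdir univ isOpen_univ).2 g (by simpa using hg)
    have hgg : g x₁ = g x₂ := by
      rw [hG x₁ ⟨trivial, trivial⟩, hG x₂ ⟨trivial, trivial⟩, ← hfac x₁ hx₁, ← hfac x₂ hx₂, hy]
    have h₁ := hgf x₁ (by simp)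
    have h₂ := hgf x₂ (by simp)
    rw [hgg] at h₁
    have htri := norm_sub_le_norm_sub_add_norm_sub (f (π' x₁)) (g x₂) (f (π' x₂))
    rw [norm_sub_rev (g x₂)] at htri
    simp only [comp_apply] at h₁ h₂
    linarith
  have hsat : ∀ V : Set Y', π ⁻¹' (σ '' V) = X' ∩ π' ⁻¹' V := by
    intro V
    ext z
    constructor
    · rintro ⟨y, hy, hyz⟩
      obtain ⟨x, hx, rfl⟩ := hred₀'.exists_preimage y
      rw [hfac x hx] at hyz
      have hfiber : X' ∩ π ⁻¹' {π x} = X' ∩ π' ⁻¹' {π' x} := by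
        ext w
        refine and_congr_right fun hw => ?_
        rw [mem_preimage, mem_preimage, mem_singleton_iff, mem_singleton_iff, ← hfac w hw,
          ← hfac x hx, hinj.eq_iff]
      have hz : z ∈ X' := hred₀.mem_of_isCompact_fiber_inter hX'open hx
        (hfiber ▸ hproper' _ isCompact_singleton) hyz.symm
      refine ⟨hz, ?_⟩
      rw [← hfac x hx, ← hfac z hz, hinj.eq_iff] at hyz
      rwa [mem_preimage, ← hyz]
    · rintro ⟨hz, hzV⟩
      exact ⟨π' z, hzV, hfac z hz⟩
  have hopen : IsOpenMap σ := by
    intro V hV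
    have hpre : IsOpen (π ⁻¹' (σ '' V)) := by
      rw [hsat]
      exact hcont'.isOpen_inter_preimage hX'open hV
    have hcompl := (hproper.isClosed_image (T := T) hcont hpre.isClosed_compl).isOpen_compl
    have hsurj : Surjective π := fun y => by
      obtain ⟨x, -, hx⟩ := hred₀.exists_preimage y
      exact ⟨x, hx⟩
    rwa [univ_inter, ← preimage_compl, image_preimage_eq _ hsurj, compl_compl] at hcompl
  refine ⟨hinj, hopen, hopen.isOpen_range, ?_⟩
  rcases isEmpty_or_nonempty Y with hempty | ⟨⟨y₀⟩⟩
  · exact ⟨isEmptyElim, ⟨fun y => isEmptyElim y, fun _ _ _ _ y => isEmptyElim y⟩,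
      fun y' => isEmptyElim (σ y'), fun y => isEmptyElim y⟩
  have : Nonempty Y' := by
    obtain ⟨x, -⟩ := hred₀.exists_preimage y₀
    exact ⟨π' x⟩
  have hτ : LeftInverse (invFun σ) σ := leftInverse_invFun hinj
  have himage : ∀ U : Set Y', range σ ∩ invFun σ ⁻¹' U = σ '' U := by
    intro U
    ext y
    constructor
    · rintro ⟨⟨y', rfl⟩, hy⟩
      exact ⟨y', by rwa [mem_preimage, hτ] at hy, rfl⟩
    · rintro ⟨y', hy, rfl⟩
      exact ⟨mem_range_self y', by rwa [mem_preimage, hτ]⟩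
  refine ⟨invFun σ, ⟨?_, ?_⟩, hτ, ?_⟩
  · rw [continuousOn_open_iff hopen.isOpen_range]
    intro U hU
    rw [himage]
    exact hopen U hU
  · intro U g hU hg
    rw [himage]
    have hpull := hholo' U g hU hg
    rw [← hsat, ← univ_inter (π ⁻¹' _)] at hpull
    obtain ⟨G, hGholo, hG⟩ := (hdir _ (hopen U hU)).2 _ hpull
    refine fun y hy => ⟨σ '' U, G, hopen U hU, hy, hGholo, ?_⟩
    rintro _ ⟨⟨y', hy', rfl⟩, -⟩
    obtain ⟨x, hx, rfl⟩ := hred₀'.exists_preimage y'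
    rw [comp_apply, hτ]
    have hGx := hG x ⟨trivial, π' x, hy', hfac x hx⟩
    rwa [← hfac x hx, comp_apply] at hGx
  · rintro _ ⟨y', rfl⟩
    rw [hτ]
end
end

section
/- Let S be a holomorphically convex complex analytic space with Remmert reduction π: S → T. A compact set K ⊂ S is O(S)-convex if and only if K = π⁻¹(π(K)) and π(K) is O(T)-convex in T. -/
/-!
Preliminary definitions.

We model a (reduced) complex analytic space as a Hausdorff topological space
equipped with a sheaf of continuous ℂ-valued functions (its holomorphic
functions) which is locally isomorphic to the canonical model: an analytic
subset `A` of an open set `Ω ⊆ ℂⁿ`, with the sheaf of functions that locally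
extend to holomorphic functions of the ambient ℂⁿ.
-/

open Set Topology Filter Function

noncomputable section

namespace CStruct

variable {X Y : Type} [TopologicalSpace X] [TopologicalSpace Y]

theorem holoOn_univ_iff (S : CStruct X) (f : X → ℂ) :
    S.HoloOn Set.univ f ↔ S.O.Holo Set.univ f := by
  refine ⟨fun hf => S.O.glue isOpen_univ fun x _ => ?_,
    fun hf x _ => ⟨Set.univ, f, isOpen_univ, mem_univ x, hf, fun _ _ => rfl⟩⟩
  obtain ⟨W, F, -, hxW, hF, hfF⟩ := hf x (mem_univ x)
  exact ⟨W, hxW, subset_univ W, S.O.congr_holo hF fun y hy => (hfF y ⟨hy, mem_univ y⟩).symm⟩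

theorem firstCountableTopology (S : CStruct X) : FirstCountableTopology X := by
  refine ⟨fun x => ?_⟩
  obtain ⟨U, n, Ω, A, h, hU, hxU, -, -, hcont, -, -, hopen, -⟩ := S.locallyModel x
  have hnhds : 𝓝 x = comap h (𝓝 (h x)) ⊓ 𝓟 U := by
    refine le_antisymm (le_inf ?_ (le_principal_iff.2 (hU.mem_nhds hxU))) fun W hW => ?_
    · exact (hcont.continuousAt (hU.mem_nhds hxU)).le_comap
    · obtain ⟨O, hOW, hO, hxO⟩ := mem_nhds_iff.1 hW
      obtain ⟨V, hV, hOV⟩ := (hopen (U ∩ O) inter_subset_left).1 (hU.inter hO)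
      have hxV : h x ∈ V := (hOV.subset ⟨hxU, hxO⟩).2
      have hmem : h ⁻¹' V ∩ U ∈ comap h (𝓝 (h x)) ⊓ 𝓟 U :=
        inter_mem_inf (preimage_mem_comap (hV.mem_nhds hxV)) (mem_principal_self U)
      exact mem_of_superset hmem fun z hz => hOW (hOV.superset ⟨hz.2, hz.1⟩).2
  rw [hnhds]
  infer_instance

theorem isClosed_range_of_isProperOn (T : CStruct Y) {π : X → Y} (hcont : Continuous π)
    (hproper : IsProperOn Set.univ π) : IsClosed (range π) := by
  have := T.t2
  have := T.firstCountableTopology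
  refine IsSeqClosed.isClosed fun u y hu huy => ?_
  have hQ := ((hproper _ huy.isCompact_insert_range).image hcont).isClosed
  refine image_subset_range _ _ (hQ.mem_of_tendsto huy (Eventually.of_forall fun n => ?_))
  obtain ⟨x, hx⟩ := hu n
  exact ⟨x, ⟨mem_univ x, Or.inr ⟨n, hx.symm⟩⟩, hx⟩

theorem IsRemmertReduction.surjective {S : CStruct X} {T : CStruct Y} {π : X → Y}
    (hred : S.IsRemmertReduction T π) : Surjective π := by
  obtain ⟨-, ⟨hcont, -⟩, hproper, hdirect⟩ := hred
  intro y
  by_contra hy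
  have hopen : IsOpen (range π)ᶜ :=
    (T.isClosed_range_of_isProperOn (continuousOn_univ.1 hcont) hproper).isOpen_compl
  exact zero_ne_one ((hdirect _ hopen).1 (fun _ => 0) (fun _ => 1) (T.O.const_mem hopen 0)
    (T.O.const_mem hopen 1) (fun x hx => absurd (mem_range_self x) hx.2) y hy)

theorem IsRemmertReduction.hullIn_eq_preimage {S : CStruct X} {T : CStruct Y} {π : X → Y}
    (hred : S.IsRemmertReduction T π) (K : Set X) :
    S.hullIn Set.univ K = π ⁻¹' T.hullIn Set.univ (π '' K) := by
  obtain ⟨-, ⟨-, hpull⟩, -, hdirect⟩ := hred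
  ext x
  constructor
  · rintro ⟨-, hx⟩
    refine ⟨mem_univ _, fun g hg => ?_⟩
    have hgπ := hpull Set.univ g isOpen_univ ((T.holoOn_univ_iff g).1 hg)
    rw [preimage_univ, inter_univ] at hgπ
    simpa only [image_image, comp_apply] using hx (g ∘ π) hgπ
  · rintro ⟨-, hx⟩
    refine ⟨mem_univ _, fun f hf => ?_⟩
    obtain ⟨g, hg, hfg⟩ := (hdirect Set.univ isOpen_univ).2 f (by simpa using hf)
    obtain rfl : f = g ∘ π := funext fun z => hfg z ⟨mem_univ z, mem_univ _⟩
    simpa only [image_image, comp_apply] using hx g ((T.holoOn_univ_iff g).2 hg)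

end CStruct

/-- Let `S` be a holomorphically convex complex space with
Remmert reduction `π : S → T`.  A compact set `K ⊆ S` is `O(S)`-convex if and
only if `K = π⁻¹(π(K))` and `π(K)` is `O(T)`-convex in `T`. -/
theorem hull_eq_iff_saturated_and_image_convex
    {X Y : Type} [TopologicalSpace X] [TopologicalSpace Y]
    (S : CStruct X) (T : CStruct Y)
    (hconv : S.HolConvex)
    (π : X → Y) (hred : S.IsRemmertReduction T π)
    (K : Set X) (hK : IsCompact K) :
    S.hullIn Set.univ K = K ↔
      (K = π ⁻¹' (π '' K) ∧ T.hullIn Set.univ (π '' K) = π '' K) := by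
  rw [hred.hullIn_eq_preimage K]
  constructor
  · intro h
    have himage : T.hullIn Set.univ (π '' K) = π '' K := by
      conv_rhs => rw [← h, image_preimage_eq _ hred.surjective]
    exact ⟨by rw [himage] at h; exact h.symm, himage⟩
  · rintro ⟨hsat, himage⟩
    rw [himage, ← hsat]
end
end
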